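/- Generalized Moreau identity: for any proper closed convex function φ : ℝ^n → ℝ ∪ {+∞} and any symmetric positive definite M ∈ ℝ^{n×n}, every x ∈ ℝ^n satisfies x = prox^M_φ(x) + M^{-1} prox^{M^{-1}}_{φ*}(Mx), where prox^M_φ(x) = argmin_y { φ(y) + ½‖y − x‖²_M } and φ* is the Fenchel conjugate of φ. -/

import Mathlib

open Matrix Filter

noncomputable section

/-- Euclidean norm of a vector. -/
def nrm {ι : Type*} [Fintype ι] (x : ι → ℝ) : ℝ := Real.sqrt (x ⬝ᵥ x)

/-- A function into the extended reals is proper: never `⊥` and somewhere finite. -/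
def ProperE {ι : Type*} (f : (ι → ℝ) → EReal) : Prop :=
  (∃ x, f x ≠ ⊤) ∧ ∀ x, f x ≠ ⊥

/-- Convexity of an extended-real-valued function. -/
def ConvexE {ι : Type*} (f : (ι → ℝ) → EReal) : Prop :=
  ∀ x y : ι → ℝ, ∀ t : ℝ, 0 ≤ t → t ≤ 1 →
    f (t • x + (1 - t) • y) ≤ (t : EReal) * f x + ((1 - t : ℝ) : EReal) * f y

/-- `μ`-strong convexity of an extended-real-valued function. -/
def StrongConvexE {ι : Type*} [Fintype ι] (μ : ℝ) (f : (ι → ℝ) → EReal) : Prop :=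
  ∀ x y : ι → ℝ, ∀ t : ℝ, 0 ≤ t → t ≤ 1 →
    f (t • x + (1 - t) • y) + ((μ / 2 * (t * (1 - t)) * ((x - y) ⬝ᵥ (x - y)) : ℝ) : EReal) ≤
      (t : EReal) * f x + ((1 - t : ℝ) : EReal) * f y

/-- Fenchel conjugate. -/
def conjE {ι : Type*} [Fintype ι] (f : (ι → ℝ) → EReal) (y : ι → ℝ) : EReal :=
  ⨆ x : ι → ℝ, ((x ⬝ᵥ y : ℝ) : EReal) - f x

/-- `v` is a subgradient of `f` at `x`. -/
def SubgradAt {ι : Type*} [Fintype ι] (f : (ι → ℝ) → EReal) (x v : ι → ℝ) : Prop :=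
  ∀ z, f x + (((z - x) ⬝ᵥ v : ℝ) : EReal) ≤ f z

/-- `p = prox^M_φ(x)`: `p` minimizes `φ(·) + ½‖· − x‖²_M`. -/
def IsProxPt {ι : Type*} [Fintype ι] (M : Matrix ι ι ℝ) (φ : (ι → ℝ) → EReal)
    (x p : ι → ℝ) : Prop :=
  ∀ w, φ p + (((1 / 2 : ℝ) * ((p - x) ⬝ᵥ M.mulVec (p - x)) : ℝ) : EReal) ≤
       φ w + (((1 / 2 : ℝ) * ((w - x) ⬝ᵥ M.mulVec (w - x)) : ℝ) : EReal)

/-- Smallest eigenvalue of a symmetric matrix, via the Rayleigh quotient. -/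
def lamMin {ι : Type*} [Fintype ι] (M : Matrix ι ι ℝ) : ℝ :=
  sInf {r | ∃ v : ι → ℝ, v ⬝ᵥ v = 1 ∧ r = v ⬝ᵥ M.mulVec v}

/-- Largest eigenvalue of a symmetric matrix, via the Rayleigh quotient. -/
def lamMax {ι : Type*} [Fintype ι] (M : Matrix ι ι ℝ) : ℝ :=
  sSup {r | ∃ v : ι → ℝ, v ⬝ᵥ v = 1 ∧ r = v ⬝ᵥ M.mulVec v}

/-- Spectral (operator 2-) norm of a matrix. -/
def specNorm {ι κ : Type*} [Fintype ι] [Fintype κ] (A : Matrix ι κ ℝ) : ℝ :=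
  sSup {r | ∃ v : κ → ℝ, v ⬝ᵥ v = 1 ∧ r = nrm (A.mulVec v)}

theorem Matrix.PosDef.dotProduct_mulVec_comm {ι : Type*} [Fintype ι] {M : Matrix ι ι ℝ}
    (hM : M.PosDef) (a b : ι → ℝ) : a ⬝ᵥ M *ᵥ b = b ⬝ᵥ M *ᵥ a := by
  have hT : Mᵀ = M := by simpa using hM.isHermitian.eq
  rw [Matrix.dotProduct_mulVec, ← Matrix.mulVec_transpose, hT, dotProduct_comm]

/-- A proximal point of a proper function lies in its effective domain. -/
theorem IsProxPt.ne_top {ι : Type*} [Fintype ι] {M : Matrix ι ι ℝ} {φ : (ι → ℝ) → EReal}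
    {x p : ι → ℝ} (hφ : ProperE φ) (hp : IsProxPt M φ x p) : φ p ≠ ⊤ := by
  obtain ⟨w, hw⟩ := hφ.1
  intro h
  have := hp w
  rw [h, EReal.top_add_coe, top_le_iff] at this
  exact EReal.add_ne_top hw (EReal.coe_ne_top _) this

theorem nonneg_of_forall_mul_add_sq_mul_nonneg {c d : ℝ}
    (h : ∀ t : ℝ, 0 < t → t ≤ 1 → 0 ≤ t * c + t ^ 2 * d) : 0 ≤ c := by
  by_contra! hc
  have hc' : 0 < |c| := abs_pos.mpr hc.ne
  have hd : 0 < |d| + |c| := by positivity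
  have hpos : 0 < |c| / (2 * (|d| + |c|)) := by positivity
  have hle : |c| / (2 * (|d| + |c|)) ≤ 1 := by
    rw [div_le_one (by positivity)]
    linarith [abs_nonneg d, abs_nonneg c]
  have key := h _ hpos hle
  set t := |c| / (2 * (|d| + |c|)) with ht
  have hmul : t * (2 * (|d| + |c|)) = |c| := by rw [ht]; field_simp
  have hcd : 0 ≤ c + t * d := by
    by_contra! hneg
    nlinarith [mul_neg_of_pos_of_neg hpos hneg]
  have : t * d ≤ t * |d| := mul_le_mul_of_nonneg_left (le_abs_self d) hpos.le
  have : 0 ≤ t * |c| := by positivity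
  linarith [abs_of_neg hc]

/-- Optimality condition of the proximal operator: `M (x - p)` is a subgradient at `p`. -/
theorem IsProxPt.subgradAt {ι : Type*} [Fintype ι] {M : Matrix ι ι ℝ} {φ : (ι → ℝ) → EReal}
    {x p : ι → ℝ} (hφ : ProperE φ) (hφv : ConvexE φ) (hM : M.PosDef)
    (hp : IsProxPt M φ x p) : SubgradAt φ p (M *ᵥ (x - p)) := by
  intro z
  by_cases hz : φ z = ⊤
  · rw [hz]; exact le_top
  obtain ⟨a, ha⟩ : ∃ a : ℝ, (a : EReal) = φ p :=
    ⟨_, EReal.coe_toReal (hp.ne_top hφ) (hφ.2 p)⟩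
  obtain ⟨b, hb⟩ : ∃ b : ℝ, (b : EReal) = φ z := ⟨_, EReal.coe_toReal hz (hφ.2 z)⟩
  rw [← ha, ← hb]
  norm_cast
  suffices 0 ≤ b - a - (z - p) ⬝ᵥ M *ᵥ (x - p) by linarith
  refine nonneg_of_forall_mul_add_sq_mul_nonneg
    (d := 1 / 2 * ((z - p) ⬝ᵥ M *ᵥ (z - p))) fun t ht0 ht1 => ?_
  have hconv := hφv z p t ht0.le ht1
  have hle := (hp (t • z + (1 - t) • p)).trans (add_le_add_left hconv _)
  rw [← ha, ← hb] at hle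
  norm_cast at hle
  have hw : t • z + (1 - t) • p - x = t • (z - p) - (x - p) := by module
  have hpx : p - x = -(x - p) := by abel
  rw [hw, hpx] at hle
  have hsymm := hM.dotProduct_mulVec_comm (x - p) (z - p)
  generalize z - p = u at *
  generalize x - p = v at *
  simp only [Matrix.mulVec_sub, Matrix.mulVec_smul, Matrix.mulVec_neg, dotProduct_sub,
    sub_dotProduct, dotProduct_smul, smul_dotProduct, neg_dotProduct, dotProduct_neg,
    smul_eq_mul, hsymm] at hle
  linarith

theorem SubgradAt.conjE_le {ι : Type*} [Fintype ι] {φ : (ι → ℝ) → EReal} {p u : ι → ℝ} {a : ℝ}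
    (ha : (a : EReal) = φ p) (h : SubgradAt φ p u) :
    conjE φ u ≤ ((p ⬝ᵥ u - a : ℝ) : EReal) := by
  refine iSup_le fun z => ?_
  have hz := h z
  rw [← ha, ← EReal.coe_add] at hz
  refine (EReal.sub_le_sub le_rfl hz).trans ?_
  rw [← EReal.coe_sub, EReal.coe_le_coe_iff, sub_dotProduct]
  linarith

/-- generalized Moreau identity.  For any proper closed convex `φ` and
any symmetric positive definite `M`, every `x` satisfies
`x = prox^M_φ(x) + M⁻¹ prox^{M⁻¹}_{φ*}(Mx)`. -/
theorem generalized_moreau_identity {n : ℕ}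
    (φ : (Fin n → ℝ) → EReal)
    (hφp : ProperE φ) (hφc : LowerSemicontinuous φ) (hφv : ConvexE φ)
    (M : Matrix (Fin n) (Fin n) ℝ) (hM : M.PosDef)
    (x p q : Fin n → ℝ)
    (hp : IsProxPt M φ x p)
    (hq : IsProxPt M⁻¹ (conjE φ) (M.mulVec x) q) :
    x = p + M⁻¹.mulVec q := by
  obtain ⟨a, ha⟩ : ∃ a : ℝ, (a : EReal) = φ p :=
    ⟨_, EReal.coe_toReal (hp.ne_top hφp) (hφp.2 p)⟩
  have hupper := (hp.subgradAt hφp hφv hM).conjE_le ha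
  have hlower : ((p ⬝ᵥ q - a : ℝ) : EReal) ≤ conjE φ q := by
    rw [EReal.coe_sub, ha]
    exact le_iSup (fun z : Fin n → ℝ => ((z ⬝ᵥ q : ℝ) : EReal) - φ z) p
  have hle := (add_le_add_left hlower _).trans
    ((hq (M *ᵥ (x - p))).trans (add_le_add_left hupper _))
  norm_cast at hle
  have hdet : IsUnit M.det := hM.det_pos.ne'.isUnit
  obtain ⟨r, rfl⟩ : ∃ r, q = M *ᵥ r := ⟨M⁻¹ *ᵥ q, by simp [Matrix.mul_nonsing_inv M hdet]⟩
  have hinv (v : Fin n → ℝ) : M⁻¹ *ᵥ (M *ᵥ v) = v := by simp [Matrix.nonsing_inv_mul M hdet]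
  simp only [← Matrix.mulVec_sub, hinv] at hle ⊢
  by_contra hne
  have hpos := hM.dotProduct_mulVec_pos (x := p + r - x) fun h => hne (sub_eq_zero.mp h).symm
  simp only [star_trivial] at hpos
  rw [dotProduct_comm (M *ᵥ (r - x)), dotProduct_comm (M *ᵥ (x - p - x))] at hle
  have hpr := hM.dotProduct_mulVec_comm r p
  have hpx := hM.dotProduct_mulVec_comm x p
  have hrx := hM.dotProduct_mulVec_comm x r
  simp only [Matrix.mulVec_sub, Matrix.mulVec_add, dotProduct_sub, dotProduct_add,
    sub_dotProduct, add_dotProduct, hpr, hpx, hrx] at hle hpos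
  linarith
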